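/- arXiv:1311.0944 — 2 statements merged into one kernel-verified Lean document; each statement's English description precedes it below -/
import Mathlib

section
/- Let M be a matroid on a finite ground set U that is not the free matroid (i.e., 𝒞(M) ≠ ∅). Then M is connected if and only if for every nonempty proper subset X ⊂ U there exists x ∈ overline{R(M)}(X) such that x ∉ X. -/
open Set

/-- A circuit of a matroid `M`: a minimal dependent subset of the ground set. -/
def IsCircuit {α : Type*} (M : Matroid α) (C : Set α) : Prop :=
  M.Dep C ∧ ∀ D, D ⊂ C → M.Indep D

/-- The relation `R(M)` induced from the matroid `M`:
`x R(M) y` iff there is a circuit of `M` containing both `x` and `y`. -/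
def matroidRel {α : Type*} (M : Matroid α) (x y : α) : Prop :=
  ∃ C, IsCircuit M C ∧ x ∈ C ∧ y ∈ C

/-- The successor neighborhood `R(M)N(x) = {y | x R(M) y}`. -/
def nbhd {α : Type*} (M : Matroid α) (x : α) : Set α :=
  {y | matroidRel M x y}

/-- The upper approximation of `X` with respect to `R(M)`. -/
def upperApprox {α : Type*} (M : Matroid α) (X : Set α) : Set α :=
  {x | (nbhd M x ∩ X).Nonempty}

/-- A matroid (with ground set the whole type) is connected iff every pair of
distinct elements lies in a common circuit. -/
def MatroidConnected {α : Type*} (M : Matroid α) : Prop :=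
  ∀ x y : α, x ≠ y → ∃ C, IsCircuit M C ∧ x ∈ C ∧ y ∈ C

theorem isCircuit_iff_matroid_isCircuit {α : Type*} {M : Matroid α} {C : Set α} :
    IsCircuit M C ↔ M.IsCircuit C :=
  Matroid.isCircuit_iff_forall_ssubset.symm

/-- In a finitary matroid, if a circuit through `x` meets a circuit through `z`, then some circuit
contains both `x` and `z`. -/
theorem Matroid.IsCircuit.exists_isCircuit_mem_mem_of_inter_nonempty {α : Type*} {M : Matroid α}
    [M.Finitary] {C₁ C₂ : Set α} {x z : α} (hC₁ : M.IsCircuit C₁) (hC₂ : M.IsCircuit C₂)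
    (hx : x ∈ C₁) (hz : z ∈ C₂) (hne : (C₁ ∩ C₂).Nonempty) :
    ∃ C, M.IsCircuit C ∧ x ∈ C ∧ z ∈ C := by
  induction hn : (C₁ ∪ C₂).ncard using Nat.strong_induction_on generalizing C₁ C₂ with
  | _ n ih =>
  subst hn
  have hfin : (C₁ ∪ C₂).Finite := hC₁.finite.union hC₂.finite
  by_cases hzC₁ : z ∈ C₁
  · exact ⟨C₁, hC₁, hx, hzC₁⟩
  by_cases hxC₂ : x ∈ C₂
  · exact ⟨C₂, hC₂, hxC₂, hz⟩
  obtain ⟨e, he₁, he₂⟩ := hne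
  obtain ⟨C₃, hC₃ss, hC₃, hxC₃⟩ := hC₁.strong_elimination hC₂ he₁ he₂ hx hxC₂
  obtain ⟨C₄, hC₄ss, hC₄, hzC₄⟩ := hC₂.strong_elimination hC₁ he₂ he₁ hz hzC₁
  have he₃ : e ∉ C₃ := fun h ↦ (hC₃ss h).2 rfl
  have he₄ : e ∉ C₄ := fun h ↦ (hC₄ss h).2 rfl
  have hC₃u : C₃ ⊆ C₁ ∪ C₂ := fun a ha ↦ (hC₃ss ha).1
  have hC₄u : C₄ ⊆ C₁ ∪ C₂ := fun a ha ↦ (hC₄ss ha).1.symm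
  obtain ⟨f, hf₃, hf₁⟩ : ∃ f ∈ C₃, f ∉ C₁ := not_subset.1 fun h ↦
    he₃ (hC₃.eq_of_subset_isCircuit hC₁ h ▸ he₁)
  obtain ⟨g, hg₄, hg₂⟩ : ∃ g ∈ C₄, g ∉ C₂ := not_subset.1 fun h ↦
    he₄ (hC₄.eq_of_subset_isCircuit hC₂ h ▸ he₂)
  by_cases hsub : C₂ \ C₁ ⊆ C₄
  · refine ih _ (ncard_lt_ncard ?_ hfin) hC₃ hC₄ hxC₃ hzC₄
      ⟨f, hf₃, hsub ⟨(hC₃u hf₃).resolve_left hf₁, hf₁⟩⟩ rfl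
    exact (ssubset_iff_of_subset (union_subset hC₃u hC₄u)).2
      ⟨e, .inl he₁, fun h ↦ h.elim he₃ he₄⟩
  · obtain ⟨w, ⟨hw₂, hw₁⟩, hw₄⟩ := not_subset.1 hsub
    refine ih _ (ncard_lt_ncard ?_ hfin) hC₁ hC₄ hx hzC₄
      ⟨g, (hC₄u hg₄).resolve_right hg₂, hg₄⟩ rfl
    exact (ssubset_iff_of_subset (union_subset subset_union_left hC₄u)).2
      ⟨w, .inr hw₂, fun h ↦ h.elim hw₁ hw₄⟩

theorem matroidRel_symm {α : Type*} {M : Matroid α} {x y : α} (h : matroidRel M x y) :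
    matroidRel M y x :=
  let ⟨C, hC, hx, hy⟩ := h
  ⟨C, hC, hy, hx⟩

theorem matroidRel_trans {α : Type*} {M : Matroid α} [M.Finitary] {x y z : α}
    (hxy : matroidRel M x y) (hyz : matroidRel M y z) : matroidRel M x z := by
  obtain ⟨C₁, hC₁, hx, hy₁⟩ := hxy
  obtain ⟨C₂, hC₂, hy₂, hz⟩ := hyz
  rw [isCircuit_iff_matroid_isCircuit] at hC₁ hC₂
  simpa only [matroidRel, isCircuit_iff_matroid_isCircuit] using
    hC₁.exists_isCircuit_mem_mem_of_inter_nonempty hC₂ hx hz ⟨y, hy₁, hy₂⟩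

theorem matroidConnected_iff_exists_mem_upperApprox_not_mem {α : Type*} [Fintype α]
    (M : Matroid α) (hE : M.E = Set.univ) (hM : {C | IsCircuit M C}.Nonempty) :
    MatroidConnected M ↔
      ∀ X : Set α, X.Nonempty → X ⊂ Set.univ →
        ∃ x ∈ upperApprox M X, x ∉ X := by
  have : M.Finite := ⟨M.E.toFinite⟩
  refine ⟨fun h X ⟨x, hx⟩ hX ↦ ?_, fun h x z hxz ↦ ?_⟩
  · obtain ⟨y, hy⟩ := (ne_univ_iff_exists_notMem X).1 hX.ne
    exact ⟨y, ⟨x, h y x (ne_of_mem_of_not_mem hx hy).symm, hx⟩, hy⟩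
  · by_contra hR
    obtain ⟨w, ⟨y, hwy, hy⟩, hw⟩ := h (insert x (nbhd M x)) (insert_nonempty _ _)
      (ssubset_univ_iff.2 ((ne_univ_iff_exists_notMem _).2
        ⟨z, fun hz ↦ hz.elim (fun h ↦ hxz h.symm) hR⟩))
    obtain rfl | hxy := hy
    · exact hw (.inr (matroidRel_symm hwy))
    · exact hw (.inr (matroidRel_trans hxy (matroidRel_symm hwy)))
end

section
/- Let M be a matroid on a finite ground set U that is not the free matroid (i.e., 𝒞(M) ≠ ∅), and suppose the union of all circuits of M equals U, i.e., ⋃𝒞(M) = U. Then M is connected if and only if overline{R(M)}(X) ≠ X for every nonempty proper subset X ⊂ U. -/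
open Set

theorem Matroid.IsCircuit.exists_isCircuit_mem_mem {α : Type*} {M : Matroid α} [M.Finitary]
    {C₁ C₂ : Set α} {x z : α} (hC₁ : M.IsCircuit C₁) (hC₂ : M.IsCircuit C₂)
    (hx : x ∈ C₁) (hz : z ∈ C₂) (h : (C₁ ∩ C₂).Nonempty) :
    ∃ C, M.IsCircuit C ∧ x ∈ C ∧ z ∈ C := by
  induction hn : (C₁ ∪ C₂).ncard using Nat.strong_induction_on generalizing C₁ C₂ with
  | _ n ih =>
  subst hn
  have hfin : (C₁ ∪ C₂).Finite := hC₁.finite.union hC₂.finite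
  by_cases hxC₂ : x ∈ C₂
  · exact ⟨C₂, hC₂, hxC₂, hz⟩
  by_cases hzC₁ : z ∈ C₁
  · exact ⟨C₁, hC₁, hx, hzC₁⟩
  obtain ⟨y, hy₁, hy₂⟩ := h
  obtain ⟨C₃, hC₃s, hC₃, hxC₃⟩ := hC₁.strong_elimination hC₂ hy₁ hy₂ hx hxC₂
  by_cases hzC₃ : z ∈ C₃
  · exact ⟨C₃, hC₃, hxC₃, hzC₃⟩
  have hC₃C₁ : ¬ C₃ ⊆ C₁ := fun hs ↦ by
    have := hC₃.eq_of_subset_isCircuit hC₁ hs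
    exact (hC₃s (this ▸ hy₁)).2 rfl
  obtain ⟨f, hf₃, hf₁⟩ := Set.not_subset.1 hC₃C₁
  have hf₂ : f ∈ C₂ := (hC₃s hf₃).1.resolve_left hf₁
  obtain ⟨C₄, hC₄s, hC₄, hzC₄⟩ := hC₂.strong_elimination hC₃ hf₂ hf₃ hz hzC₃
  have hC₄C₂ : ¬ C₄ ⊆ C₂ := fun hs ↦ by
    have := hC₄.eq_of_subset_isCircuit hC₂ hs
    exact (hC₄s (this ▸ hf₂)).2 rfl
  obtain ⟨g, hg₄, hg₂⟩ := Set.not_subset.1 hC₄C₂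
  have hg₁ : g ∈ C₁ := (hC₃s ((hC₄s hg₄).1.resolve_left hg₂)).1.resolve_right hg₂
  refine ih _ (Set.ncard_lt_ncard ?_ hfin) hC₁ hC₄ hx hzC₄ ⟨g, hg₁, hg₄⟩ rfl
  refine ⟨Set.union_subset Set.subset_union_left fun a ha ↦ ?_, fun hs ↦ ?_⟩
  · exact (hC₄s ha).1.elim Or.inr fun ha₃ ↦ (hC₃s ha₃).1
  · exact (hs (Or.inr hf₂)).elim hf₁ fun hf₄ ↦ (hC₄s hf₄).2 rfl

theorem matroidConnected_iff_upperApprox_ne {α : Type*} [Fintype α]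
    (M : Matroid α) (hE : M.E = Set.univ) (hM : {C | IsCircuit M C}.Nonempty)
    (hU : ⋃₀ {C | IsCircuit M C} = Set.univ) :
    MatroidConnected M ↔
      ∀ X : Set α, X.Nonempty → X ⊂ Set.univ → upperApprox M X ≠ X := by
  have hrefl (x : α) : matroidRel M x x := by
    obtain ⟨C, hC, hx⟩ : x ∈ ⋃₀ {C | IsCircuit M C} := hU ▸ Set.mem_univ x
    exact ⟨C, hC, hx, hx⟩
  refine ⟨fun h X ⟨x, hx⟩ hX heq ↦ ?_, fun h x y _ ↦ ?_⟩
  · obtain ⟨y, -, hy⟩ := Set.exists_of_ssubset hX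
    have hyx : y ∈ upperApprox M X := ⟨x, h y x (ne_of_mem_of_not_mem hx hy).symm, hx⟩
    exact hy (heq ▸ hyx)
  · by_contra hxy
    refine h (nbhd M x) ⟨x, hrefl x⟩ (Set.ssubset_univ_iff.2 fun he ↦ ?_) ?_
    · have hy : y ∈ nbhd M x := he ▸ Set.mem_univ y
      exact hxy hy
    · ext a
      exact ⟨fun ⟨b, hab, hxb⟩ ↦ matroidRel_trans hxb (matroidRel_symm hab),
        fun ha ↦ ⟨a, hrefl a, ha⟩⟩
end
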